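/- arXiv:2403.18075 — 2 statements merged into one kernel-verified Lean document; each statement's English description precedes it below -/
import Mathlib

section
/- Assume that for each a ∈ {1, 3} there are infinitely many primes p with p ≡ a (mod 4) and 2^{p−1} ≢ 1 (mod p²). Then for all rational numbers c₁, c₂ the following holds: if there exists N such that for every prime p > N one has c₁·T_p(1) + c₂·T_p(1̄) = 0 in ℤ/pℤ (with c₁, c₂ cast into ℤ/pℤ), then c₁ = c₂ = 0. Here T_p(1) = Σ_{0 < k < p, k odd} k^{−1} and T_p(1̄) = Σ_{0 < k < p, k odd} (−1)^{(k−1)/2} k^{−1} in ℤ/pℤ. In other words, under the stated hypothesis, T_𝒜(1) and T_𝒜(1̄) are ℚ-linearly independent in 𝒜. -/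
/-- `T_p(1) = Σ_{0 < k < p, k odd} k⁻¹` in `ℤ/pℤ`. -/
def Tone (p : ℕ) : ZMod p :=
  ∑ k ∈ (Finset.Ioo 0 p).filter (fun k => k % 2 = 1), (k : ZMod p)⁻¹

/-- `T_p(1̄) = Σ_{0 < k < p, k odd} (−1)^{(k−1)/2} k⁻¹` in `ℤ/pℤ`. -/
def ToneBar (p : ℕ) : ZMod p :=
  ∑ k ∈ (Finset.Ioo 0 p).filter (fun k => k % 2 = 1),
    (-1 : ZMod p) ^ ((k - 1) / 2) * (k : ZMod p)⁻¹

/-- Reduction of a rational number mod `p` (numerator over denominator). -/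
def rQ (p : ℕ) (x : ℚ) : ZMod p := (x.num : ZMod p) * ((x.den : ℕ) : ZMod p)⁻¹

section HarmonicSums

open Finset

lemma choose_pred_cast_zmod (p : ℕ) [Fact p.Prime] (j : ℕ) (hj : j < p) :
    ((p - 1).choose j : ZMod p) = (-1) ^ j := by
  induction j with
  | zero => simp
  | succ j ih =>
    have hp : p.Prime := Fact.out
    have h1 : p.choose (j + 1) = (p - 1).choose j + (p - 1).choose (j + 1) := by
      conv_lhs => rw [← Nat.sub_add_cancel hp.one_le]
      exact Nat.choose_succ_succ _ _
    have h2 : (p.choose (j + 1) : ZMod p) = 0 :=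
      (ZMod.natCast_eq_zero_iff _ _).2 (hp.dvd_choose_self (by omega) hj)
    rw [h1] at h2
    push_cast at h2
    rw [ih (by omega)] at h2
    rw [pow_succ]
    linear_combination h2

lemma natCast_ne_zero_zmod {p k : ℕ} (hk : 0 < k) (hkp : k < p) : (k : ZMod p) ≠ 0 :=
  fun h => Nat.not_dvd_of_pos_of_lt hk hkp ((ZMod.natCast_eq_zero_iff _ _).1 h)

/-- Dividing `p.choose k` by `p` gives `(-1) ^ (k - 1) / k` modulo `p`. -/
lemma choose_div_cast_zmod (p : ℕ) [Fact p.Prime] {k : ℕ} (hk : 0 < k) (hkp : k < p) :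
    ((p.choose k / p : ℕ) : ZMod p) = (-1) ^ (k - 1) * (k : ZMod p)⁻¹ := by
  have hp : p.Prime := Fact.out
  rw [eq_mul_inv_iff_mul_eq₀ (natCast_ne_zero_zmod hk hkp),
    ← choose_pred_cast_zmod p (k - 1) (by omega), ← Nat.cast_mul]
  congr 1
  obtain ⟨c, hc⟩ := hp.dvd_choose_self hk.ne' hkp
  have h := Nat.add_one_mul_choose_eq (p - 1) (k - 1)
  rw [Nat.sub_add_cancel hp.one_le, Nat.sub_add_cancel hk, hc] at h
  rw [hc, Nat.mul_div_cancel_left _ hp.pos]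
  refine Nat.eq_of_mul_eq_mul_left hp.pos ?_
  rw [h, mul_assoc]

lemma sum_range_succ_eq_ends_add_sum_Ioo {M : Type*} [AddCommMonoid M] {p : ℕ}
    (hp : 0 < p) (f : ℕ → M) :
    ∑ k ∈ range (p + 1), f k = f 0 + f p + ∑ k ∈ Ioo 0 p, f k := by
  rw [sum_range_succ, range_eq_Ico, ← add_sum_Ioo_eq_sum_Ico hp]
  abel

lemma sum_even_neg_inv (p : ℕ) [Fact p.Prime] (hodd : p % 2 = 1) :
    ∑ k ∈ (Ioo 0 p).filter (fun k => ¬ k % 2 = 1), -(k : ZMod p)⁻¹ = Tone p := by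
  refine sum_nbij' (fun k => p - k) (fun k => p - k) ?_ ?_ ?_ ?_ ?_
  any_goals
    intro k hk
    simp only [mem_filter, mem_Ioo] at hk ⊢
    omega
  intro k hk
  simp only [mem_filter, mem_Ioo] at hk
  rw [Nat.cast_sub hk.1.2.le]
  simp [inv_neg]

/-- `Tone p` is the Fermat quotient of `p` in base `2`. -/
lemma Tone_eq_fermatQuotient (p : ℕ) [Fact p.Prime] (hodd : p % 2 = 1) {q : ℤ}
    (hq : (2 : ℤ) ^ (p - 1) = 1 + p * q) : Tone p = q := by
  have hp : p.Prime := Fact.out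
  have hp0 : (p : ℤ) ≠ 0 := by exact_mod_cast hp.ne_zero
  have h2 : (2 : ZMod p) ≠ 0 := by
    have := natCast_ne_zero_zmod (p := p) (k := 2) two_pos (by have := hp.two_le; omega)
    exact_mod_cast this
  have hsum : (2 : ℤ) ^ p = 2 + p * ∑ k ∈ Ioo 0 p, ((p.choose k / p : ℕ) : ℤ) := by
    have h := Nat.sum_range_choose p
    rw [sum_range_succ_eq_ends_add_sum_Ioo hp.pos] at h
    simp only [Nat.choose_zero_right, Nat.choose_self] at h
    rw [mul_sum]
    have h' : ∑ k ∈ Ioo 0 p, (p : ℤ) * ((p.choose k / p : ℕ) : ℤ)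
        = ∑ k ∈ Ioo 0 p, (p.choose k : ℤ) := by
      refine sum_congr rfl fun k hk => ?_
      rw [mem_Ioo] at hk
      exact_mod_cast Nat.mul_div_cancel' (hp.dvd_choose_self hk.1.ne' hk.2)
    rw [h']
    exact_mod_cast h.symm
  have hB : ∑ k ∈ Ioo 0 p, ((p.choose k / p : ℕ) : ℤ) = 2 * q := by
    refine mul_left_cancel₀ hp0 ?_
    have hpow : (2 : ℤ) ^ p = 2 ^ (p - 1) * 2 := by
      rw [← pow_succ, Nat.sub_add_cancel hp.one_le]
    rw [hpow, hq] at hsum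
    linear_combination -hsum
  have hB' := congrArg (Int.cast : ℤ → ZMod p) hB
  push_cast only [Int.cast_sum, Int.cast_natCast, Int.cast_mul, Int.cast_ofNat] at hB'
  rw [← sum_filter_add_sum_filter_not _ (fun k => k % 2 = 1)] at hB'
  have hodd_part : ∑ k ∈ (Ioo 0 p).filter (fun k => k % 2 = 1), ((p.choose k / p : ℕ) : ZMod p)
      = Tone p := by
    refine sum_congr rfl fun k hk => ?_
    simp only [mem_filter, mem_Ioo] at hk
    rw [choose_div_cast_zmod p hk.1.1 hk.1.2, Even.neg_one_pow, one_mul]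
    exact Nat.even_iff.2 (by omega)
  have heven_part :
      ∑ k ∈ (Ioo 0 p).filter (fun k => ¬ k % 2 = 1), ((p.choose k / p : ℕ) : ZMod p)
        = Tone p := by
    rw [← sum_even_neg_inv p hodd]
    refine sum_congr rfl fun k hk => ?_
    simp only [mem_filter, mem_Ioo] at hk
    rw [choose_div_cast_zmod p hk.1.1 hk.1.2, Odd.neg_one_pow, neg_one_mul]
    exact Nat.odd_iff.2 (by omega)
  rw [hodd_part, heven_part] at hB'
  refine mul_left_cancel₀ h2 ?_
  linear_combination hB'

lemma gaussian_I_mul_self : (⟨0, 1⟩ : GaussianInt) * ⟨0, 1⟩ = -1 := by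
  ext <;> simp

lemma gaussian_I_pow_two_mul (m : ℕ) :
    (⟨0, 1⟩ : GaussianInt) ^ (2 * m) = (((-1) ^ m : ℤ) : GaussianInt) := by
  rw [pow_mul, pow_two, gaussian_I_mul_self]
  push_cast
  rfl

lemma gaussian_I_pow_even_im {k : ℕ} (hk : k % 2 = 0) :
    ((⟨0, 1⟩ : GaussianInt) ^ k).im = 0 := by
  obtain ⟨m, rfl⟩ := Nat.dvd_of_mod_eq_zero hk
  rw [gaussian_I_pow_two_mul, Zsqrtd.im_intCast]

lemma gaussian_I_pow_odd_im {k : ℕ} (hk : k % 2 = 1) :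
    ((⟨0, 1⟩ : GaussianInt) ^ k).im = (-1) ^ ((k - 1) / 2) := by
  obtain ⟨m, rfl⟩ : ∃ m, k = 2 * m + 1 := ⟨k / 2, by omega⟩
  rw [pow_succ, gaussian_I_pow_two_mul, show (2 * m + 1 - 1) / 2 = m by omega]
  simp only [Zsqrtd.im_mul, Zsqrtd.im_intCast, Zsqrtd.re_intCast]
  ring

lemma gaussian_I_pow_re_add_im_sq (m : ℕ) :
    (((⟨0, 1⟩ : GaussianInt) ^ m).re + ((⟨0, 1⟩ : GaussianInt) ^ m).im) ^ 2 = 1 := by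
  suffices h : ∀ x y : ℤ, (⟨0, 1⟩ : GaussianInt) ^ m = ⟨x, y⟩ → x * y = 0 ∧ x ^ 2 + y ^ 2 = 1 by
    obtain ⟨h1, h2⟩ := h _ _ rfl
    linear_combination 2 * h1 + h2
  induction m with
  | zero =>
    intro x y h
    rw [pow_zero, Zsqrtd.ext_iff] at h
    simp at h
    simp [← h.1, ← h.2]
  | succ m ih =>
    intro x y h
    obtain ⟨h1, h2⟩ := ih _ _ rfl
    rw [pow_succ, Zsqrtd.ext_iff] at h
    simp only [Zsqrtd.im_mul, Zsqrtd.re_mul] at h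
    rw [← h.1, ← h.2]
    constructor
    · linear_combination -h1
    · linear_combination h2

lemma gaussian_one_add_I_pow_im_sq {p : ℕ} (hodd : p % 2 = 1) :
    (((1 + ⟨0, 1⟩ : GaussianInt) ^ p).im) ^ 2 = 2 ^ (p - 1) := by
  obtain ⟨m, rfl⟩ : ∃ m, p = 2 * m + 1 := ⟨p / 2, by omega⟩
  have hsq : (1 + ⟨0, 1⟩ : GaussianInt) ^ 2 = ((2 : ℤ) : GaussianInt) * ⟨0, 1⟩ := by
    ext <;> simp [pow_two]
  rw [pow_succ (1 + ⟨0, 1⟩ : GaussianInt), pow_mul (1 + ⟨0, 1⟩ : GaussianInt), hsq, mul_pow,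
    ← Int.cast_pow]
  have h := gaussian_I_pow_re_add_im_sq m
  simp only [Zsqrtd.im_mul, Zsqrtd.re_mul, Zsqrtd.im_intCast, Zsqrtd.re_intCast, Zsqrtd.im_add,
    Zsqrtd.re_add, Zsqrtd.re_one, Zsqrtd.im_one, Nat.add_sub_cancel]
  rw [pow_mul, pow_right_comm]
  linear_combination ((2 : ℤ) ^ m) ^ 2 * h

/-- Twice `ToneBar p` is, up to the sign `(-1) ^ ((p - 1) / 2)`, the Fermat quotient of `p` in
base `2`. -/
lemma two_mul_ToneBar_eq (p : ℕ) [Fact p.Prime] (hodd : p % 2 = 1) {q : ℤ}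
    (hq : (2 : ℤ) ^ (p - 1) = 1 + p * q) :
    2 * (-1) ^ ((p - 1) / 2) * ToneBar p = q := by
  have hp : p.Prime := Fact.out
  have hp0 : (p : ℤ) ≠ 0 := by exact_mod_cast hp.ne_zero
  set A : ℤ := ∑ k ∈ Ioo 0 p, ((⟨0, 1⟩ : GaussianInt) ^ k).im * ((p.choose k / p : ℕ) : ℤ) with hA
  have him : ((1 + ⟨0, 1⟩ : GaussianInt) ^ p).im = (-1) ^ ((p - 1) / 2) + p * A := by
    have hterm : ∀ k, ((⟨0, 1⟩ : GaussianInt) ^ k * 1 ^ (p - k) * (p.choose k : GaussianInt)).im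
        = ((⟨0, 1⟩ : GaussianInt) ^ k).im * (p.choose k : ℤ) := by
      intro k
      simp [Zsqrtd.im_mul]
    have him_sum : ∀ (s : Finset ℕ) (f : ℕ → GaussianInt),
        (∑ k ∈ s, f k).im = ∑ k ∈ s, (f k).im := by
      intro s f
      induction s using Finset.cons_induction with
      | empty => simp
      | cons a s ha ih => rw [sum_cons, sum_cons, Zsqrtd.im_add, ih]
    rw [add_comm, add_pow, him_sum, sum_congr rfl fun k _ => hterm k,
      sum_range_succ_eq_ends_add_sum_Ioo hp.pos, gaussian_I_pow_odd_im hodd, hA, mul_sum]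
    simp only [pow_zero, Zsqrtd.im_one, zero_mul, zero_add, Nat.choose_self, Nat.cast_one, mul_one]
    congr 1
    refine sum_congr rfl fun k hk => ?_
    rw [mem_Ioo] at hk
    have h := Nat.mul_div_cancel' (hp.dvd_choose_self hk.1.ne' hk.2)
    have h' : (p : ℤ) * ((p.choose k / p : ℕ) : ℤ) = (p.choose k : ℤ) := by exact_mod_cast h
    rw [← h']
    ring
  have hAT : (A : ZMod p) = ToneBar p := by
    rw [hA, Int.cast_sum, ToneBar, ← sum_filter_add_sum_filter_not _ (fun k => k % 2 = 1)]
    rw [sum_eq_zero (s := (Ioo 0 p).filter fun k => ¬ k % 2 = 1), add_zero]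
    · refine sum_congr rfl fun k hk => ?_
      simp only [mem_filter, mem_Ioo] at hk
      rw [Int.cast_mul, Int.cast_natCast, choose_div_cast_zmod p hk.1.1 hk.1.2,
        gaussian_I_pow_odd_im hk.2, Even.neg_one_pow (n := k - 1), one_mul]
      · push_cast
        rfl
      · exact Nat.even_iff.2 (by omega)
    · intro k hk
      simp only [mem_filter, mem_Ioo] at hk
      rw [gaussian_I_pow_even_im (by omega), zero_mul, Int.cast_zero]
  have hsq := gaussian_one_add_I_pow_im_sq hodd
  rw [him, hq] at hsq
  have hs : ((-1 : ℤ) ^ ((p - 1) / 2)) ^ 2 = 1 := by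
    rw [pow_right_comm, neg_one_sq, one_pow]
  have hkey : 2 * (-1) ^ ((p - 1) / 2) * A + p * A ^ 2 = q := by
    refine mul_left_cancel₀ hp0 ?_
    linear_combination hsq - hs
  have := congrArg (Int.cast : ℤ → ZMod p) hkey
  push_cast at this
  rw [hAT, ZMod.natCast_self, zero_mul, add_zero] at this
  exact this

/-- If the reduction of `2 * c₁ + s * c₂` vanishes modulo infinitely many primes, then this
rational number is zero. -/
lemma two_mul_add_mul_eq_zero_of_infinite {S : Set ℕ} (hS : S.Infinite) (c₁ c₂ : ℚ)
    (s : ℤ) (h : ∀ p ∈ S, p.Prime ∧ 2 * rQ p c₁ + s * rQ p c₂ = 0) :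
    2 * c₁ + s * c₂ = 0 := by
  set n : ℤ := 2 * c₁.num * c₂.den + s * c₂.num * c₁.den with hn
  have hd₁ : (c₁.den : ℚ) ≠ 0 := by exact_mod_cast c₁.den_ne_zero
  have hd₂ : (c₂.den : ℚ) ≠ 0 := by exact_mod_cast c₂.den_ne_zero
  have hn0 : n = 0 := by
    obtain ⟨p, hpS, hpn⟩ := hS.exists_gt (c₁.den * c₂.den + n.natAbs)
    obtain ⟨hp, hc⟩ := h p hpS
    have := Fact.mk hp
    have hlt : c₁.den * c₂.den < p := by omega
    have h₁ : (c₁.den : ZMod p) ≠ 0 := natCast_ne_zero_zmod c₁.den_pos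
      (lt_of_le_of_lt (Nat.le_mul_of_pos_right _ c₂.den_pos) hlt)
    have h₂ : (c₂.den : ZMod p) ≠ 0 := natCast_ne_zero_zmod c₂.den_pos
      (lt_of_le_of_lt (Nat.le_mul_of_pos_left _ c₁.den_pos) hlt)
    have hz : (n : ZMod p) = 0 := by
      rw [rQ, rQ] at hc
      field_simp at hc
      rw [hn]
      push_cast
      linear_combination hc
    rw [ZMod.intCast_zmod_eq_zero_iff_dvd] at hz
    exact Int.eq_zero_of_abs_lt_dvd hz (by rw [Int.abs_eq_natAbs]; omega)
  have hq : (n : ℚ) = 0 := by exact_mod_cast hn0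
  rw [← c₁.num_div_den, ← c₂.num_div_den]
  field_simp
  rw [hn] at hq
  push_cast at hq
  linear_combination hq

end HarmonicSums

/-- Assume that for each `a ∈ {1, 3}` there are infinitely many primes
`p ≡ a (mod 4)` with `2^{p−1} ≢ 1 (mod p²)`. Then for all rationals `c₁, c₂`:
if `c₁ T_p(1) + c₂ T_p(1̄) = 0` in `ℤ/pℤ` for all sufficiently large primes
`p`, then `c₁ = c₂ = 0`; i.e. `T_𝒜(1)` and `T_𝒜(1̄)` are `ℚ`-linearly
independent in `𝒜`. -/
theorem T_one_T_bar_one_linear_independent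
    (hyp : ∀ a : ℕ, a = 1 ∨ a = 3 →
      {p : ℕ | p.Prime ∧ p % 4 = a ∧ ¬ (2 ^ (p - 1) ≡ 1 [MOD p ^ 2])}.Infinite)
    (c₁ c₂ : ℚ) :
    (∃ N : ℕ, ∀ p : ℕ, N < p → p.Prime →
      rQ p c₁ * Tone p + rQ p c₂ * ToneBar p = 0) →
    c₁ = 0 ∧ c₂ = 0 := by
  rintro ⟨N, hN⟩
  have key : ∀ a : ℕ, ∀ s : ℤ, a = 1 ∨ a = 3 → (∀ p : ℕ, p % 4 = a → (-1) ^ ((p - 1) / 2) = s) →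
      2 * c₁ + s * c₂ = 0 := by
    intro a s ha hs
    refine two_mul_add_mul_eq_zero_of_infinite ((hyp a ha).sdiff (Set.finite_Iic N)) c₁ c₂ s ?_
    rintro p ⟨⟨hp, hpa, hw⟩, hpN⟩
    refine ⟨hp, ?_⟩
    have := Fact.mk hp
    have hodd : p % 2 = 1 := by omega
    have hrel := hN p (not_le.1 hpN) hp
    obtain ⟨q, hq⟩ : (p : ℤ) ∣ 2 ^ (p - 1) - 1 := by
      refine (Int.ModEq.dvd (Int.ModEq.pow_card_sub_one_eq_one hp ?_).symm)
      rw [Int.isCoprime_iff_gcd_eq_one]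
      exact (Nat.coprime_primes Nat.prime_two hp).2 (by rintro rfl; omega)
    have hq' : (2 : ℤ) ^ (p - 1) = 1 + p * q := by linear_combination hq
    have hq0 : (q : ZMod p) ≠ 0 := by
      intro h0
      rw [ZMod.intCast_zmod_eq_zero_iff_dvd] at h0
      obtain ⟨r, rfl⟩ := h0
      refine hw ((Nat.modEq_iff_dvd.2 ⟨-r, ?_⟩))
      push_cast
      linear_combination -hq
    have hT := Tone_eq_fermatQuotient p hodd hq'
    have hTb := two_mul_ToneBar_eq p hodd hq'
    have hs' : ((-1 : ZMod p) ^ ((p - 1) / 2)) = s := by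
      rw [← hs p hpa]
      push_cast
      rfl
    have hs2 : (s : ZMod p) ^ 2 = 1 := by
      rw [← hs', pow_right_comm, neg_one_sq, one_pow]
    rw [hs'] at hTb
    refine (mul_eq_zero.1 ?_).resolve_right hq0
    rw [hT] at hrel
    linear_combination 2 * hrel - rQ p c₂ * s * hTb + 2 * rQ p c₂ * ToneBar p * hs2
  have h1 := key 1 1 (.inl rfl) fun p hp => Even.neg_one_pow (Nat.even_iff.2 (by omega))
  have h3 := key 3 (-1) (.inr rfl) fun p hp => Odd.neg_one_pow (Nat.odd_iff.2 (by omega))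
  push_cast at h1 h3
  constructor <;> linarith
end

section
/- Depth-one evaluations: (a) for every odd prime p, S_p(1) = −T_p(1) = −q_p in ℤ/pℤ, where T_p(1) = Σ_{0 < k < p, k odd} k^{−1} and S_p(1) = Σ_{0 < k < p, k even} k^{−1}; (b) for every integer s ≥ 2 there exists N such that for every prime p > N, S_p(s) = −T_p(s) = (2^{1−s} − 1)·(B_{p−s}/s) in ℤ/pℤ, where T_p(s) = Σ_{0 < k < p, k odd} k^{−s} and S_p(s) = Σ_{0 < k < p, k even} k^{−s}. -/
/-- `T_p(s) = Σ_{0 < k < p, k odd} k⁻ˢ` in `ℤ/pℤ`. -/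
def ToddP (p s : ℕ) : ZMod p :=
  ∑ k ∈ (Finset.Ioo 0 p).filter (fun k => k % 2 = 1), ((k : ZMod p) ^ s)⁻¹

/-- `S_p(s) = Σ_{0 < k < p, k even} k⁻ˢ` in `ℤ/pℤ`. -/
def SevenP (p s : ℕ) : ZMod p :=
  ∑ k ∈ (Finset.Ioo 0 p).filter (fun k => k % 2 = 0), ((k : ZMod p) ^ s)⁻¹

/-- The Fermat quotient `q_p = (2^{p−1} − 1)/p`, reduced mod `p`. -/
def qF (p : ℕ) : ZMod p := (((2 ^ (p - 1) - 1) / p : ℕ) : ZMod p)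

section PIntegral

variable {p : ℕ} [Fact p.Prime]

/-- The subring of `ℚ` of `p`-integral rational numbers. -/
abbrev pIntegers (p : ℕ) [Fact p.Prime] : Subring ℚ := (Rat.padicValuation p).integer

lemma mem_pIntegers_iff {x : ℚ} : x ∈ pIntegers p ↔ ¬ p ∣ x.den := by
  rw [Valuation.mem_integer_iff, Rat.padicValuation_le_one_iff]

lemma inv_natCast_mem_pIntegers {n : ℕ} (h0 : 0 < n) (hn : n < p) : ((n : ℚ))⁻¹ ∈ pIntegers p := by
  rw [mem_pIntegers_iff, Rat.inv_natCast_den_of_pos h0]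
  exact Nat.not_dvd_of_pos_of_lt h0 hn

lemma bernoulli'_mem_pIntegers {n : ℕ} (hn : n + 1 < p) : bernoulli' n ∈ pIntegers p := by
  induction n using Nat.strong_induction_on with
  | _ n ih =>
    rw [bernoulli'_def]
    refine sub_mem (one_mem _) (sum_mem fun k hk => ?_)
    rw [Finset.mem_range] at hk
    refine mul_mem ?_ (ih k hk (by omega))
    rw [div_eq_mul_inv]
    refine mul_mem (natCast_mem _ _) ?_
    have h := inv_natCast_mem_pIntegers (p := p) (n := n - k + 1) (by omega) (by omega)
    rwa [Nat.cast_add, Nat.cast_sub hk.le, Nat.cast_one] at h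

lemma bernoulli_mem_pIntegers {n : ℕ} (hn : n + 1 < p) : bernoulli n ∈ pIntegers p :=
  mul_mem (pow_mem (neg_mem (one_mem _)) _) (bernoulli'_mem_pIntegers hn)

/-- `∑_{k < p} k ^ n ≡ p B_n` modulo `p ^ 2`, for `1 ≤ n ≤ p - 2`. -/
lemma exists_sum_range_pow_eq {n : ℕ} (h0 : 0 < n) (hn : n + 1 < p) :
    ∃ R ∈ pIntegers p,
      ∑ k ∈ Finset.range p, (k : ℚ) ^ n = p * bernoulli n + (p : ℚ) ^ 2 * R := by
  refine ⟨∑ i ∈ Finset.range n,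
    bernoulli i * (n + 1).choose i * (p : ℚ) ^ (n - 1 - i) * ((n + 1 : ℕ) : ℚ)⁻¹,
    sum_mem fun i hi => ?_, ?_⟩
  · rw [Finset.mem_range] at hi
    exact mul_mem (mul_mem (mul_mem (bernoulli_mem_pIntegers (by omega)) (natCast_mem _ _))
      (pow_mem (natCast_mem _ _) _)) (inv_natCast_mem_pIntegers (by omega) hn)
  · have hn' : (n : ℚ) + 1 ≠ 0 := by positivity
    rw [sum_range_pow, Finset.sum_range_succ, add_comm, Finset.mul_sum]
    congr 1
    · rw [Nat.choose_succ_self_right, Nat.add_sub_cancel_left]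
      push_cast
      field_simp
    · refine Finset.sum_congr rfl fun i hi => ?_
      rw [Finset.mem_range] at hi
      rw [show n + 1 - i = n - 1 - i + 2 by omega]
      push_cast
      field_simp
      ring

lemma intCast_eq_zero_of_eq_mul {M : ℤ} {r : ℚ} (hr : r ∈ pIntegers p) (h : (M : ℚ) = p * r) :
    (M : ZMod p) = 0 := by
  have hden : ((r.den : ℕ) : ZMod p) ≠ 0 := by
    rw [Ne, ZMod.natCast_eq_zero_iff]
    exact mem_pIntegers_iff.mp hr
  have h1 : M * (r.den : ℤ) = p * r.num := by
    have : (M : ℚ) * r.den = p * r.num := by rw [h, mul_assoc, Rat.mul_den_eq_num]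
    exact_mod_cast this
  have h2 := congrArg (Int.cast : ℤ → ZMod p) h1
  push_cast at h2
  rw [CharP.cast_eq_zero (ZMod p) p, zero_mul] at h2
  exact (mul_eq_zero.mp h2).resolve_right hden

lemma rQ_intCast_div (a : ℤ) {b : ℤ} (hb : (b : ZMod p) ≠ 0) :
    rQ p ((a : ℚ) / b) = (a : ZMod p) / b := by
  set x : ℚ := (a : ℚ) / b with hx
  have hb0 : b ≠ 0 := by rintro rfl; simp at hb
  have hdvd : (x.den : ℤ) ∣ b := by
    rw [hx, ← Rat.divInt_eq_div]
    exact Rat.den_dvd a b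
  have hden : ((x.den : ℕ) : ZMod p) ≠ 0 := by
    obtain ⟨c, hc⟩ := hdvd
    intro h
    apply hb
    rw [hc]
    push_cast
    rw [h, zero_mul]
  have h1 : x.num * b = a * x.den := by
    have h2 : x * b = a := by rw [hx]; exact div_mul_cancel₀ _ (by exact_mod_cast hb0)
    have : (x.num : ℚ) * b = a * x.den := by rw [← Rat.mul_den_eq_num, ← h2]; ring
    exact_mod_cast this
  have h3 := congrArg (Int.cast : ℤ → ZMod p) h1
  push_cast at h3
  rw [rQ, ← div_eq_mul_inv, div_eq_div_iff hden hb, h3]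

end PIntegral

lemma sum_range_two_mul_add_one {M : Type*} [AddCommMonoid M] (f : ℕ → M) (h : ℕ) :
    ∑ k ∈ Finset.range (2 * h + 1), f k =
      ∑ j ∈ Finset.range (h + 1), f (2 * j) + ∑ j ∈ Finset.range h, f (2 * j + 1) := by
  induction h with
  | zero => simp
  | succ h ih =>
    rw [show 2 * (h + 1) + 1 = 2 * h + 1 + 1 + 1 by ring, Finset.sum_range_succ,
      Finset.sum_range_succ, ih, Finset.sum_range_succ _ (h + 1),
      Finset.sum_range_succ (fun j => f (2 * j + 1)) h]
    rw [show 2 * h + 1 + 1 = 2 * (h + 1) by ring]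
    abel

/-- Doubling modulo `2 h + 1` permutes the residues, which compares power sums modulo
`(2 h + 1) ^ 2`. -/
lemma exists_two_pow_sub_one_mul_sum (h m : ℕ) :
    ∃ K : ℤ, (2 ^ (m + 1) - 1) * ∑ k ∈ Finset.range (2 * h + 1), (k : ℤ) ^ (m + 1) =
      (2 * h + 1) * ((m + 1) * ∑ j ∈ Finset.range h, (2 * j + 1 : ℤ) ^ m) +
        (2 * h + 1) ^ 2 * K := by
  have key : ∀ x y : ℤ, ∃ z, (x + y) ^ (m + 1) - x ^ (m + 1) = y * ((m + 1) * x ^ m) + y ^ 2 * z := by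
    intro x y
    obtain ⟨z, hz⟩ := Polynomial.powAddExpansion x y (m + 1)
    refine ⟨z, ?_⟩
    rw [hz]
    push_cast
    ring
  choose z hz using key
  refine ⟨∑ j ∈ Finset.range h, z (2 * j + 1) (2 * h + 1), ?_⟩
  have h1 := sum_range_two_mul_add_one (fun k => (k : ℤ) ^ (m + 1)) h
  have h2 : 2 ^ (m + 1) * ∑ k ∈ Finset.range (2 * h + 1), (k : ℤ) ^ (m + 1) =
      ∑ j ∈ Finset.range (h + 1), (2 * j : ℤ) ^ (m + 1) +
      ∑ j ∈ Finset.range h, ((2 * j + 1 : ℤ) + (2 * h + 1)) ^ (m + 1) := by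
    rw [show 2 * h + 1 = h + 1 + h by ring, Finset.sum_range_add, mul_add, Finset.mul_sum,
      Finset.mul_sum]
    congr 1 <;> refine Finset.sum_congr rfl fun j _ => ?_
    · rw [mul_pow]
    · rw [← mul_pow]
      push_cast
      ring
  push_cast at h1
  rw [sub_mul, one_mul, h2, h1, add_sub_add_left_eq_sub, ← Finset.sum_sub_distrib]
  simp only [hz, Finset.sum_add_distrib, Finset.mul_sum]

section PowerSums

variable {p : ℕ} [Fact p.Prime]

lemma inv_pow_eq_pow {s : ℕ} (h0 : 0 < s) (hs : s < p - 1) (x : ZMod p) :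
    (x ^ s)⁻¹ = x ^ (p - 1 - s) := by
  rcases eq_or_ne x 0 with rfl | hx
  · rw [zero_pow h0.ne', inv_zero, zero_pow (by omega)]
  · refine (eq_inv_of_mul_eq_one_left ?_).symm
    rw [← pow_add, Nat.sub_add_cancel hs.le, ZMod.pow_card_sub_one_eq_one hx]

lemma toddP_eq_sum_range {h : ℕ} (hp : p = 2 * h + 1) (s : ℕ) :
    ToddP p s = ∑ j ∈ Finset.range h, ((2 * j + 1 : ZMod p) ^ s)⁻¹ := by
  symm
  refine Finset.sum_nbij' (fun j => 2 * j + 1) (fun k => k / 2) ?_ ?_ ?_ ?_ ?_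
  · intro j hj
    simp only [Finset.mem_range, Finset.mem_filter, Finset.mem_Ioo] at *
    omega
  · intro j hj
    simp only [Finset.mem_range, Finset.mem_filter, Finset.mem_Ioo] at *
    omega
  · intro j hj
    omega
  · intro j hj
    simp only [Finset.mem_filter] at hj
    omega
  · intro j hj
    push_cast
    rfl

lemma toddP_add_sevenP (s : ℕ) :
    ToddP p s + SevenP p s = ∑ k ∈ Finset.Ioo 0 p, ((k : ZMod p) ^ s)⁻¹ := by
  rw [← Finset.sum_filter_add_sum_filter_not _ (fun k => k % 2 = 1), ToddP, SevenP]
  simp only [Nat.mod_two_not_eq_one]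

lemma sum_range_natCast {M : Type*} [AddCommMonoid M] (f : ZMod p → M) :
    ∑ k ∈ Finset.range p, f k = ∑ x, f x :=
  Finset.sum_nbij' (fun k => (k : ZMod p)) ZMod.val (fun _ _ => Finset.mem_univ _)
    (fun x _ => Finset.mem_range.mpr x.val_lt)
    (fun _ hk => ZMod.val_cast_of_lt (Finset.mem_range.mp hk))
    (fun x _ => ZMod.natCast_zmod_val x) (fun _ _ => rfl)

lemma sevenP_eq_neg_toddP {s : ℕ} (h0 : 0 < s) (hs : s < p - 1) :
    SevenP p s = -(ToddP p s) := by
  rw [eq_neg_iff_add_eq_zero, add_comm, toddP_add_sevenP]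
  have h1 : ∑ k ∈ Finset.Ioo 0 p, ((k : ZMod p) ^ s)⁻¹ =
      ∑ k ∈ Finset.range p, (k : ZMod p) ^ (p - 1 - s) := by
    simp only [inv_pow_eq_pow h0 hs]
    refine Finset.sum_subset (fun k hk => Finset.mem_range.mpr (Finset.mem_Ioo.mp hk).2)
      fun k hk hk' => ?_
    obtain rfl : k = 0 := by
      simp only [Finset.mem_range, Finset.mem_Ioo] at hk hk'
      omega
    rw [Nat.cast_zero, zero_pow (by omega)]
  rw [h1, sum_range_natCast (fun x => x ^ (p - 1 - s))]
  exact FiniteField.sum_pow_lt_card_sub_one _ _ (by rw [ZMod.card]; omega)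

/-- `C(p - 1, k) ≡ (-1) ^ k` modulo `p`. -/
lemma natCast_choose_prime_sub_one {k : ℕ} (hk : k < p) :
    (((p - 1).choose k : ℕ) : ZMod p) = (-1) ^ k := by
  induction k with
  | zero => simp
  | succ k ih =>
    have hp : p - 1 + 1 = p := Nat.sub_add_cancel (Fact.out : p.Prime).one_le
    have h := Nat.choose_succ_succ' (p - 1) k
    rw [hp] at h
    have h0 : ((p.choose (k + 1) : ℕ) : ZMod p) = 0 :=
      (ZMod.natCast_eq_zero_iff _ _).mpr
        ((Fact.out : p.Prime).dvd_choose_self (Nat.succ_ne_zero k) hk)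
    rw [h, Nat.cast_add, ih (by omega)] at h0
    rw [pow_succ, mul_neg_one]
    exact eq_neg_of_add_eq_zero_right h0

lemma natCast_choose_prime_div {k : ℕ} (h0 : 0 < k) (hk : k < p) :
    ((p.choose k / p : ℕ) : ZMod p) = -(-1) ^ k * ((k : ZMod p))⁻¹ := by
  have hp : p.Prime := Fact.out
  have hk0 : (k : ZMod p) ≠ 0 := by
    rw [Ne, ZMod.natCast_eq_zero_iff]
    exact Nat.not_dvd_of_pos_of_lt h0 hk
  obtain ⟨c, hc⟩ := hp.dvd_choose_self h0.ne' hk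
  obtain ⟨j, rfl⟩ := Nat.exists_eq_succ_of_ne_zero h0.ne'
  have h1 := Nat.add_one_mul_choose_eq (p - 1) j
  rw [Nat.sub_add_cancel hp.one_le, ← Nat.succ_eq_add_one j, hc, mul_assoc] at h1
  have h2 := congrArg (Nat.cast : ℕ → ZMod p) (Nat.eq_of_mul_eq_mul_left hp.pos h1)
  rw [natCast_choose_prime_sub_one (by omega), Nat.cast_mul] at h2
  rw [hc, Nat.mul_div_cancel_left _ hp.pos, eq_mul_inv_iff_mul_eq₀ hk0, ← h2, pow_succ]
  ring

lemma two_mul_fermatQuotient (hp2 : p ≠ 2) :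
    2 * ((2 ^ (p - 1) - 1) / p) = ∑ k ∈ Finset.Ioo 0 p, p.choose k / p := by
  have hp : p.Prime := Fact.out
  apply Nat.eq_of_mul_eq_mul_left hp.pos
  have hdvd : p ∣ 2 ^ (p - 1) - 1 :=
    (Nat.modEq_iff_dvd' Nat.one_le_two_pow).mp (by
      simpa [Nat.totient_prime hp] using
        (Nat.ModEq.pow_totient ((Nat.coprime_primes Nat.prime_two hp).mpr hp2.symm)).symm)
  rw [mul_left_comm, Nat.mul_div_cancel' hdvd, Finset.mul_sum,
    Finset.sum_congr rfl fun k hk => Nat.mul_div_cancel'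
      (hp.dvd_choose_self (Finset.mem_Ioo.mp hk).1.ne' (Finset.mem_Ioo.mp hk).2)]
  have h1 := Nat.sum_range_choose p
  rw [Finset.sum_range_succ, Finset.range_eq_Ico, Finset.sum_eq_sum_Ico_succ_bot hp.pos] at h1
  have h2 : Finset.Ico (0 + 1) p = Finset.Ioo 0 p := by ext; simp; omega
  have h3 : 2 ^ p = 2 * 2 ^ (p - 1) := by rw [← pow_succ', Nat.sub_add_cancel hp.one_le]
  rw [h2, Nat.choose_zero_right, Nat.choose_self] at h1
  omega

lemma toddP_one_sub_sevenP_one :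
    ToddP p 1 - SevenP p 1 = ∑ k ∈ Finset.Ioo 0 p, ((p.choose k / p : ℕ) : ZMod p) := by
  rw [← Finset.sum_filter_add_sum_filter_not _ (fun k => k % 2 = 1), ToddP, SevenP, sub_eq_add_neg,
    ← Finset.sum_neg_distrib]
  simp only [Nat.mod_two_not_eq_one]
  congr 1 <;> refine Finset.sum_congr rfl fun k hk => ?_ <;>
    obtain ⟨hk1, hk2⟩ := Finset.mem_filter.mp hk <;> rw [Finset.mem_Ioo] at hk1 <;>
    rw [natCast_choose_prime_div hk1.1 hk1.2]
  · rw [(Nat.odd_iff.mpr hk2).neg_one_pow]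
    simp
  · rw [(Nat.even_iff.mpr hk2).neg_one_pow]
    simp

lemma ZMod.two_ne_zero_of_odd_prime (hp2 : p ≠ 2) : (2 : ZMod p) ≠ 0 := by
  have h : ((2 : ℕ) : ZMod p) ≠ 0 := by
    rw [Ne, ZMod.natCast_eq_zero_iff]
    exact fun h => hp2 ((Nat.prime_dvd_prime_iff_eq Fact.out Nat.prime_two).mp h)
  exact_mod_cast h

lemma sevenP_one_eq_neg_qF (hp2 : p ≠ 2) : SevenP p 1 = -(qF p) := by
  have hp : p.Prime := Fact.out
  have h1 := toddP_one_sub_sevenP_one (p := p)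
  have h2 : SevenP p 1 = -(ToddP p 1) :=
    sevenP_eq_neg_toddP one_pos (by have := hp.two_le; omega)
  rw [← Nat.cast_sum, ← two_mul_fermatQuotient hp2, Nat.cast_mul, Nat.cast_two] at h1
  refine mul_left_cancel₀ (ZMod.two_ne_zero_of_odd_prime hp2) ?_
  rw [qF]
  linear_combination -h1 + h2

lemma sevenP_eq_rQ_bernoulli {s : ℕ} (hs : 2 ≤ s) (hp : s + 1 < p) :
    SevenP p s = rQ p (((2 : ℚ) ^ ((1 : ℤ) - (s : ℤ)) - 1) * (bernoulli (p - s) / s)) := by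
  have hpp : p.Prime := Fact.out
  have hp2 : p ≠ 2 := by omega
  obtain ⟨h, hh⟩ := hpp.odd_of_ne_two hp2
  obtain ⟨m, hm⟩ : ∃ m, m = p - 1 - s := ⟨_, rfl⟩
  have hn : p - s = m + 1 := by omega
  obtain ⟨R, hR, hsum⟩ := exists_sum_range_pow_eq (p := p) (n := m + 1) (by omega) (by omega)
  obtain ⟨K, hK⟩ := exists_two_pow_sub_one_mul_sum h m
  have hB : bernoulli (m + 1) ∈ pIntegers p := bernoulli_mem_pIntegers (by omega)
  rw [hn]
  set B := bernoulli (m + 1)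
  set T : ℤ := ∑ j ∈ Finset.range h, (2 * j + 1 : ℤ) ^ m with hT
  have hden : ((B.den : ℕ) : ZMod p) ≠ 0 := by
    rw [Ne, ZMod.natCast_eq_zero_iff]
    exact mem_pIntegers_iff.mp hB
  have hs0 : (s : ZMod p) ≠ 0 := by
    rw [Ne, ZMod.natCast_eq_zero_iff]
    exact Nat.not_dvd_of_pos_of_lt (by omega) (by omega)
  have h2 := ZMod.two_ne_zero_of_odd_prime hp2
  have hTodd : ToddP p s = (T : ZMod p) := by
    rw [toddP_eq_sum_range hh, hT]
    push_cast
    exact Finset.sum_congr rfl fun j _ => by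
      rw [inv_pow_eq_pow (by omega) (by omega), hm]
  have hpQ : (2 * h + 1 : ℚ) = p := by rw [hh]; push_cast; rfl
  have hp0 : (p : ℚ) ≠ 0 := by exact_mod_cast hpp.ne_zero
  have hcong : (2 ^ (m + 1) - 1) * B - (m + 1) * T = p * (K - (2 ^ (m + 1) - 1) * R) := by
    have hK' := congrArg (Int.cast : ℤ → ℚ) hK
    rw [← hh] at hK'
    push_cast at hK'
    rw [hsum, hpQ] at hK'
    apply mul_left_cancel₀ hp0
    linear_combination hK'
  have hzero := intCast_eq_zero_of_eq_mul (p := p)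
    (M := (2 ^ (m + 1) - 1) * B.num - (m + 1) * T * B.den)
    (r := (K - (2 ^ (m + 1) - 1) * R) * B.den)
    (mul_mem (sub_mem (intCast_mem _ _) (mul_mem (sub_mem (pow_mem (ofNat_mem _ 2) _) (one_mem _))
      hR)) (natCast_mem _ _)) (by
      push_cast
      rw [← mul_assoc, ← hcong, ← Rat.mul_den_eq_num B]
      ring)
  have hx : ((2 : ℚ) ^ ((1 : ℤ) - (s : ℤ)) - 1) * (B / s) =
      (((2 - 2 ^ s) * B.num : ℤ) : ℚ) / ((2 ^ s * B.den * s : ℤ) : ℚ) := by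
    rw [zpow_sub₀ two_ne_zero, zpow_one, zpow_natCast]
    conv_lhs => rw [← Rat.num_div_den B]
    push_cast
    have hd0 : (B.den : ℚ) ≠ 0 := by exact_mod_cast B.den_ne_zero
    have hs0' : (s : ℚ) ≠ 0 := by exact_mod_cast (by omega : s ≠ 0)
    field_simp
  have hb : ((2 ^ s * B.den * s : ℤ) : ZMod p) ≠ 0 := by
    push_cast
    exact mul_ne_zero (mul_ne_zero (pow_ne_zero _ h2) hden) hs0
  rw [hx, rQ_intCast_div _ hb, eq_div_iff hb, sevenP_eq_neg_toddP (by omega) (by omega), hTodd]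
  have hms : (m : ZMod p) + 1 = -s := by
    have : ((m + 1 + s : ℕ) : ZMod p) = 0 := by
      rw [show m + 1 + s = p by omega, CharP.cast_eq_zero]
    push_cast at this
    linear_combination this
  have hpow : (2 : ZMod p) ^ s * 2 ^ (m + 1) = 2 := by
    rw [← pow_add, show s + (m + 1) = p by omega, ZMod.pow_card]
  push_cast at hzero ⊢
  rw [hms] at hzero
  linear_combination (-2 ^ s : ZMod p) * hzero + (B.num : ZMod p) * hpow

end PowerSums

/-- Depth-one evaluations: (a) for every odd prime `p`,
`S_p(1) = −T_p(1) = −q_p`; (b) for every `s ≥ 2` and all sufficiently large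
primes `p`, `S_p(s) = −T_p(s) = (2^{1−s} − 1)·(B_{p−s}/s)` in `ℤ/pℤ`. -/
theorem depth_one_evaluations :
    (∀ p : ℕ, p.Prime → p ≠ 2 →
      SevenP p 1 = -(ToddP p 1) ∧ SevenP p 1 = -(qF p)) ∧
    (∀ s : ℕ, 2 ≤ s → ∃ N : ℕ, ∀ p : ℕ, N < p → p.Prime →
      SevenP p s = -(ToddP p s) ∧
      SevenP p s = rQ p (((2 : ℚ) ^ ((1 : ℤ) - (s : ℤ)) - 1) * (bernoulli (p - s) / s))) := by
  refine ⟨fun p hp hp2 => ?_, fun s hs => ⟨s + 1, fun p hN hp => ?_⟩⟩ <;> have := Fact.mk hp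
  · exact ⟨sevenP_eq_neg_toddP one_pos (by have := hp.two_le; omega), sevenP_one_eq_neg_qF hp2⟩
  · exact ⟨sevenP_eq_neg_toddP (by omega) (by omega), sevenP_eq_rQ_bernoulli hs hN⟩
end
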